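/- Let q ∈ ℚ[X] be the polynomial q(X) = (92/9)X^9 + 46X^8 + (364/3)X^7 + 210X^6 + (3766/15)X^5 + 210X^4 + (1084/9)X^3 + 45X^2 + (149/15)X + 1. Then q(X) = (X+1)^9 + (14/15)(X+1)^8 X + (23/15)(X+1)^7 X^2 − (19/45)(X+1)^6 X^3 + (31/15)(X+1)^5 X^4 + (31/15)(X+1)^4 X^5 − (19/45)(X+1)^3 X^6 + (23/15)(X+1)^2 X^7 + (14/15)(X+1) X^8 + X^9, and there do NOT exist nonnegative rationals a_0,…,a_9 with q(X) = Σ_{i=0}^{9} a_i X^i (1+X)^{9−i}; that is, q is not magic positive. -/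

import Mathlib

open Polynomial

/-- The Ehrhart polynomial of the dual symmetric edge polytope of `K_{10}` minus an
edge. -/
noncomputable def qK10e : Polynomial ℚ :=
  C (92/9 : ℚ) * X ^ 9 + C 46 * X ^ 8 + C (364/3 : ℚ) * X ^ 7 + C 210 * X ^ 6 +
    C (3766/15 : ℚ) * X ^ 5 + C 210 * X ^ 4 + C (1084/9 : ℚ) * X ^ 3 + C 45 * X ^ 2 +
    C (149/15 : ℚ) * X + 1

/-- `qK10e` has the stated expansion in the basis `X^i (1+X)^{9-i}` and is not magic
positive. -/
theorem qK10e_not_magic_positive :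
    qK10e =
      (X + 1) ^ 9 + C (14/15 : ℚ) * (X + 1) ^ 8 * X + C (23/15 : ℚ) * (X + 1) ^ 7 * X ^ 2 -
        C (19/45 : ℚ) * (X + 1) ^ 6 * X ^ 3 + C (31/15 : ℚ) * (X + 1) ^ 5 * X ^ 4 +
        C (31/15 : ℚ) * (X + 1) ^ 4 * X ^ 5 - C (19/45 : ℚ) * (X + 1) ^ 3 * X ^ 6 +
        C (23/15 : ℚ) * (X + 1) ^ 2 * X ^ 7 + C (14/15 : ℚ) * (X + 1) * X ^ 8 + X ^ 9 ∧
    ¬ ∃ a : ℕ → ℚ, (∀ i, 0 ≤ a i) ∧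
        qK10e = ∑ i ∈ Finset.range 10, C (a i) * X ^ i * (1 + X) ^ (9 - i) := by
  constructor
  · apply Polynomial.funext
    intro x
    simp only [qK10e, eval_add, eval_sub, eval_mul, eval_C, eval_pow, eval_X, eval_one]
    ring
  · rintro ⟨a, ha, h⟩
    have key : ∀ x : ℚ, eval x qK10e = ∑ i ∈ Finset.range 10, a i * x ^ i * (1 + x) ^ (9 - i) := by
      intro x
      rw [h, eval_finset_sum]
      simp only [eval_add, eval_mul, eval_C, eval_pow, eval_X, eval_one]
    simp only [qK10e, eval_add, eval_mul, eval_C, eval_pow, eval_X, eval_one,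
      Finset.sum_range_succ, Finset.sum_range_zero] at key
    have h0 := key 0
    have h1 := key 1
    have h2 := key 2
    have h3 := key 3
    have h4 := key 4
    have m1 := key (-1)
    have m2 := key (-2)
    have m3 := key (-3)
    have m4 := key (-4)
    have m5 := key (-5)
    have h3' := ha 3
    clear key h ha
    norm_num at h0 h1 h2 h3 h4 m1 m2 m3 m4 m5
    linarith
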